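/- Fix an integer n ≥ 2 and consider the simultaneous offering instance with k = 1 and n + 1 candidates, where candidate 1 has v_1 = 1/n and p_1 = 1, and each candidate i ∈ {2,…,n+1} has v_i = 1 − 1/n and p_i = 1/n. For S ⊆ {1,…,n+1}, with B_1,…,B_{n+1} independent Bernoulli random variables with P(B_i = 1) = p_i, define the simultaneous-offering reward R(S) := E[Σ_{i∈S} v_i B_i − max(Σ_{i∈S} B_i − 1, 0)]. Then: (a) R({2,…,n+1}) = 1 − 1/n − (1 − 1/n)^n, which converges to 1 − 1/e as n → ∞; (b) every subset S with 1 ∈ S satisfies R(S) ≤ 1/n. Consequently, since v_1 p_1 = 1/n > (1 − 1/n)/n = v_i p_i for i ≥ 2, every nonempty expected-value-ordered set (a prefix of the candidates sorted in decreasing order of v_i p_i) contains candidate 1 and has reward at most 1/n, so the ratio of the best expected-value-ordered reward to max_S R(S) tends to 0 as n → ∞. -/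

import Mathlib

open Finset Filter

/-- The probability that the set of `1`-coordinates of a vector of independent Bernoulli
random variables with means `p` equals exactly `A`. -/
noncomputable def bernWeight {n : ℕ} (p : Fin n → ℝ) (A : Finset (Fin n)) : ℝ :=
  (∏ i ∈ A, p i) * ∏ i ∈ Aᶜ, (1 - p i)

/-- Expected reward of sending simultaneous offers to the set `S` with capacity `k`:
`E[∑_{i∈S} v_i B_i − max(∑_{i∈S} B_i − k, 0)]` for independent Bernoulli `B_i` of means `p i`. -/
noncomputable def simReward {n : ℕ} (k : ℕ) (p v : Fin n → ℝ) (S : Finset (Fin n)) : ℝ :=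
  ∑ A : Finset (Fin n),
    bernWeight p A * ((∑ i ∈ S ∩ A, v i) - max (((S ∩ A).card : ℝ) - (k : ℝ)) 0)

/-- The probability that no index in `S` is a success is `∏ i ∈ S, (1 - p i)`. -/
theorem sum_bernWeight_ite_disjoint {n : ℕ} (p : Fin n → ℝ) (S : Finset (Fin n)) :
    ∑ A : Finset (Fin n), bernWeight p A * (if S ∩ A = ∅ then 1 else 0) =
      ∏ i ∈ S, (1 - p i) := by
  have h := Fintype.prod_add (fun i => if i ∈ S then 0 else p i) (fun i => 1 - p i)
  have h2 : ∏ i, ((if i ∈ S then 0 else p i) + (1 - p i)) = ∏ i ∈ S, (1 - p i) := by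
    rw [← Finset.prod_subset (Finset.subset_univ S)]
    · exact Finset.prod_congr rfl fun i hi => by simp [hi]
    · intro i _ hi
      simp [hi]
  rw [← h2, h]
  refine Finset.sum_congr rfl fun A _ => ?_
  unfold bernWeight
  split_ifs with hA
  · rw [mul_one]
    congr 1
    refine Finset.prod_congr rfl fun i hi => ?_
    have : i ∉ S := fun hS => by
      have : i ∈ S ∩ A := Finset.mem_inter.2 ⟨hS, hi⟩
      simp [hA] at this
    simp [this]
  · obtain ⟨i, hi⟩ := Finset.nonempty_iff_ne_empty.2 hA
    rw [Finset.mem_inter] at hi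
    have h0 : (∏ j ∈ A, if j ∈ S then 0 else p j) = 0 :=
      Finset.prod_eq_zero hi.2 (if_pos hi.1)
    rw [h0, mul_zero, zero_mul]

theorem sum_bernWeight {n : ℕ} (p : Fin n → ℝ) :
    ∑ A : Finset (Fin n), bernWeight p A = 1 := by
  simpa using sum_bernWeight_ite_disjoint p ∅

theorem sum_bernWeight_ite_mem {n : ℕ} (p : Fin n → ℝ) (i : Fin n) :
    ∑ A : Finset (Fin n), bernWeight p A * (if i ∈ A then 1 else 0) = p i := by
  have h := sum_bernWeight_ite_disjoint p {i}
  have h1 := sum_bernWeight p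
  rw [Finset.prod_singleton] at h
  rw [← sub_sub_cancel 1 (p i), ← h]
  nth_rewrite 2 [← h1]
  rw [← Finset.sum_sub_distrib]
  refine Finset.sum_congr rfl fun A _ => ?_
  by_cases hA : i ∈ A <;> simp [hA]

theorem sum_bernWeight_mul_sum {n : ℕ} (p w : Fin n → ℝ) (S : Finset (Fin n)) :
    ∑ A : Finset (Fin n), bernWeight p A * ∑ i ∈ S ∩ A, w i = ∑ i ∈ S, p i * w i := by
  have (A : Finset (Fin n)) : bernWeight p A * ∑ i ∈ S ∩ A, w i =
      ∑ i ∈ S, bernWeight p A * (if i ∈ A then 1 else 0) * w i := by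
    rw [← Finset.filter_mem_eq_inter, Finset.sum_filter, Finset.mul_sum]
    refine Finset.sum_congr rfl fun i _ => ?_
    split_ifs <;> simp
  simp_rw [this]
  rw [Finset.sum_comm]
  refine Finset.sum_congr rfl fun i _ => ?_
  rw [← Finset.sum_mul, sum_bernWeight_ite_mem]

/-- With capacity one, the reward is the probability that some offer is accepted minus the
expected total shortfall `1 - v i` of the accepted offers. -/
theorem simReward_one {n : ℕ} (p v : Fin n → ℝ) (S : Finset (Fin n)) :
    simReward 1 p v S = 1 - ∏ i ∈ S, (1 - p i) - ∑ i ∈ S, p i * (1 - v i) := by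
  rw [← sum_bernWeight_mul_sum, ← sum_bernWeight_ite_disjoint]
  nth_rewrite 1 [← sum_bernWeight p]
  rw [← Finset.sum_sub_distrib, ← Finset.sum_sub_distrib]
  refine Finset.sum_congr rfl fun A _ => ?_
  rw [Finset.sum_sub_distrib, Finset.sum_const, nsmul_eq_mul, mul_one]
  split_ifs with hA
  · simp [hA]
  · have h : (1 : ℝ) ≤ ((S ∩ A).card : ℝ) := by
      exact_mod_cast Finset.card_pos.2 (Finset.nonempty_iff_ne_empty.2 hA)
    rw [Nat.cast_one, max_eq_left (by linarith)]
    ring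

theorem tendsto_one_sub_inv_pow :
    Tendsto (fun m : ℕ => 1 - 1/(m:ℝ) - (1 - 1/(m:ℝ))^m) atTop
      (nhds (1 - (Real.exp 1)⁻¹)) := by
  have h1 : Tendsto (fun m : ℕ => 1 - 1/(m:ℝ)) atTop (nhds (1 - 0)) :=
    tendsto_const_nhds.sub tendsto_one_div_atTop_nhds_zero_nat
  have h2 := Real.tendsto_one_add_div_pow_exp (-1)
  rw [Real.exp_neg] at h2
  rw [sub_zero] at h1
  refine h1.sub (h2.congr fun m => ?_)
  rw [neg_div, ← sub_eq_add_neg]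

/-- **Expected-value-ordered policies can be arbitrarily bad (Example: sim_EV_ordered).**
With `k = 1` and `n + 1` candidates: candidate `0` has `v = 1/n`, `p = 1`; candidates
`i ≠ 0` have `v = 1 − 1/n`, `p = 1/n`.  Then:
(a) `R({1,…,n}) = 1 − 1/n − (1 − 1/n)^n`, which tends to `1 − 1/e`;
(b) any offer set containing candidate `0` earns at most `1/n`;
(c) candidate `0` has the strictly largest product `v·p`, so every nonempty
expected-value-ordered set contains it; and the ratio `(1/n)/(1 − 1/n − (1−1/n)^n)` tends
to `0`. -/
theorem stmt18 (n : ℕ) (hn : 2 ≤ n) (p v : Fin (n+1) → ℝ)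
    (hp0 : p 0 = 1) (hp : ∀ i, i ≠ 0 → p i = 1/(n:ℝ))
    (hv0 : v 0 = 1/(n:ℝ)) (hv : ∀ i, i ≠ 0 → v i = 1 - 1/(n:ℝ)) :
    simReward 1 p v (univ \ {0}) = 1 - 1/(n:ℝ) - (1 - 1/(n:ℝ))^n ∧
    Tendsto (fun m : ℕ => 1 - 1/(m:ℝ) - (1 - 1/(m:ℝ))^m) atTop
      (nhds (1 - (Real.exp 1)⁻¹)) ∧
    (∀ S : Finset (Fin (n+1)), (0 : Fin (n+1)) ∈ S → simReward 1 p v S ≤ 1/(n:ℝ)) ∧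
    (∀ i : Fin (n+1), i ≠ 0 → v i * p i < v 0 * p 0) ∧
    Tendsto (fun m : ℕ => (1/(m:ℝ)) / (1 - 1/(m:ℝ) - (1 - 1/(m:ℝ))^m)) atTop (nhds 0) := by
  have hn' : (2:ℝ) ≤ n := by exact_mod_cast hn
  have hpos : (0:ℝ) < 1/(n:ℝ) := by positivity
  have hle : 1/(n:ℝ) ≤ 1 := by
    rw [div_le_one (by linarith)]
    linarith
  refine ⟨?_, tendsto_one_sub_inv_pow, ?_, ?_, ?_⟩
  · have hmem (i : Fin (n+1)) (hi : i ∈ (univ \ {0} : Finset (Fin (n+1)))) : i ≠ 0 := by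
      simpa using hi
    have hcard : (univ \ {0} : Finset (Fin (n+1))).card = n := by
      rw [Finset.card_sdiff_of_subset (Finset.subset_univ _)]
      simp
    rw [simReward_one,
      Finset.prod_congr rfl fun i hi => by rw [hp i (hmem i hi)],
      Finset.sum_congr rfl fun i hi => by rw [hp i (hmem i hi), hv i (hmem i hi)],
      Finset.prod_const, Finset.sum_const, hcard, nsmul_eq_mul]
    field_simp
    ring
  · intro S hS
    rw [simReward_one, Finset.prod_eq_zero hS (by rw [hp0, sub_self])]
    have hnonneg (i : Fin (n+1)) : 0 ≤ p i * (1 - v i) := by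
      by_cases hi : i = 0
      · rw [hi, hp0, hv0]
        linarith
      · rw [hp i hi, hv i hi, sub_sub_cancel]
        positivity
    have h := Finset.single_le_sum (f := fun i => p i * (1 - v i))
      (fun i _ => hnonneg i) hS
    simp only [hp0, hv0] at h
    linarith
  · intro i hi
    rw [hp i hi, hv i hi, hp0, hv0]
    nlinarith [mul_pos hpos hpos]
  · have hne : 1 - (Real.exp 1)⁻¹ ≠ 0 :=
      (sub_pos.2 (inv_lt_one_of_one_lt₀ (Real.one_lt_exp_iff.2 one_pos))).ne'
    have h := (tendsto_one_div_atTop_nhds_zero_nat (𝕜 := ℝ)).div tendsto_one_sub_inv_pow hne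
    rw [zero_div] at h
    exact h
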